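/- Let (f, C) be an outside-obstacle representation of a finite simple graph G, let Z and Z' be cliques of G, and suppose z1 z1' z2' z2 is an induced 4-cycle of G with z1, z2 ∈ Z and z1', z2' ∈ Z' (so z1z1', z1'z2', z2'z2, z2z1 are edges and z1z2', z2z1' are non-edges). If the convex hulls CH(f(Z)) and CH(f(Z')) are exactly 1-crossing, then either f(z1) and f(z2) lie in different connected components of CH(f(Z)) \ CH(f(Z')), or f(z1') and f(z2') lie in different connected components of CH(f(Z')) \ CH(f(Z)). -/

import Mathlib

noncomputable section

/-- The plane ℝ². -/
abbrev Plane : Type := EuclideanSpace ℝ (Fin 2)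

/-- A point set is in general position if no three of its points are collinear. -/
def InGenPos (P : Set Plane) : Prop :=
  ∀ p ∈ P, ∀ q ∈ P, ∀ r ∈ P, p ≠ q → p ≠ r → q ≠ r →
    ¬ Collinear ℝ ({p, q, r} : Set Plane)

/-- The union of the closed segments corresponding to the edges of `G`
in the straight-line drawing given by `f`. -/
def edgeUnion {V : Type} (G : SimpleGraph V) (f : V → Plane) : Set Plane :=
  ⋃ (u : V) (v : V) (_ : G.Adj u v), segment ℝ (f u) (f v)

/-- The unbounded connected component of the complement of the drawing. -/
def outsideRegion {V : Type} (G : SimpleGraph V) (f : V → Plane) : Set Plane :=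
  {p | p ∈ (edgeUnion G f)ᶜ ∧
       ¬ Bornology.IsBounded (connectedComponentIn (edgeUnion G f)ᶜ p)}

/-- `(f, C)` is a single-obstacle representation of `G`. -/
def IsObstacleRep {V : Type} (G : SimpleGraph V) (f : V → Plane) (C : Set Plane) : Prop :=
  Function.Injective f ∧ InGenPos (Set.range f) ∧
  IsOpen C ∧ IsConnected C ∧ Disjoint C (Set.range f) ∧
  ∀ u v : V, u ≠ v → (G.Adj u v ↔ Disjoint (segment ℝ (f u) (f v)) C)

/-- An outside-obstacle representation: the obstacle lies in the unbounded component. -/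
def IsOutsideObstacleRep {V : Type} (G : SimpleGraph V) (f : V → Plane) (C : Set Plane) : Prop :=
  IsObstacleRep G f C ∧ C ⊆ outsideRegion G f

/-- An inside-obstacle representation: the obstacle avoids the unbounded component. -/
def IsInsideObstacleRep {V : Type} (G : SimpleGraph V) (f : V → Plane) (C : Set Plane) : Prop :=
  IsObstacleRep G f C ∧ Disjoint C (outsideRegion G f)

/-- An exposed outside-obstacle representation: every vertex lies on the boundary of
the unbounded component. -/
def IsExposedOutsideObstacleRep {V : Type} (G : SimpleGraph V) (f : V → Plane)
    (C : Set Plane) : Prop :=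
  IsOutsideObstacleRep G f C ∧ ∀ v : V, f v ∈ closure (outsideRegion G f)

/-- `p` is an extreme point ("on the convex hull") of the point set `P`. -/
def IsExtremePt (p : Plane) (P : Set Plane) : Prop :=
  p ∉ convexHull ℝ (P \ {p})

/-- `S` has at least `n` connected components. -/
def AtLeastNComponents (S : Set Plane) (n : ℕ) : Prop :=
  ∃ p : Fin n → Plane, (∀ i, p i ∈ S) ∧
    ∀ i j : Fin n, i ≠ j →
      connectedComponentIn S (p i) ≠ connectedComponentIn S (p j)

/-- `S` has exactly `n` connected components. -/
def ExactlyNComponents (S : Set Plane) (n : ℕ) : Prop :=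
  ∃ p : Fin n → Plane, (∀ i, p i ∈ S) ∧
    (∀ i j : Fin n, i ≠ j →
      connectedComponentIn S (p i) ≠ connectedComponentIn S (p j)) ∧
    ∀ q ∈ S, ∃ i : Fin n, connectedComponentIn S q = connectedComponentIn S (p i)

/-- The convex hulls of `A` and `B` are at least `t`-crossing. -/
def AtLeastCrossing (A B : Set Plane) (t : ℕ) : Prop :=
  ((convexHull ℝ A) ∩ (convexHull ℝ B)).Nonempty ∧
    AtLeastNComponents ((convexHull ℝ A) \ (convexHull ℝ B)) (t + 1)

/-- The convex hulls of `A` and `B` are exactly `t`-crossing. -/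
def ExactlyCrossing (A B : Set Plane) (t : ℕ) : Prop :=
  ((convexHull ℝ A) ∩ (convexHull ℝ B)).Nonempty ∧
    ExactlyNComponents ((convexHull ℝ A) \ (convexHull ℝ B)) (t + 1)



/-- convex combination of three points -/
lemma tri_mem {E : Type*} [AddCommGroup E] [Module ℝ E] {S : Set E} (hS : Convex ℝ S) {p q r : E}
    (hp : p ∈ S) (hq : q ∈ S) (hr : r ∈ S) {α β γ : ℝ} (hα : 0 ≤ α) (hβ : 0 ≤ β) (hγ : 0 ≤ γ)
    (h : α + β + γ = 1) : α • p + β • q + γ • r ∈ S := by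
  have := hS.sum_mem (t := (Finset.univ : Finset (Fin 3))) (w := ![α, β, γ]) (z := ![p, q, r])
    (by intro i _; fin_cases i <;> simpa) (by simp [Fin.sum_univ_three, h])
    (by intro i _; fin_cases i <;> simpa)
  simpa [Fin.sum_univ_three] using this

lemma seg_mem2 {S : Set (ℝ × ℝ)} (hS : Convex ℝ S) {p q : ℝ × ℝ}
    (hp : p ∈ S) (hq : q ∈ S) {x y : ℝ} (α : ℝ) (hα : 0 ≤ α) (hα1 : α ≤ 1)
    (hx : x = (1 - α) * p.1 + α * q.1) (hy : y = (1 - α) * p.2 + α * q.2) : (x, y) ∈ S := by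
  have := hS hp hq (a := 1 - α) (b := α) (by linarith) hα (by ring)
  have h2 : (x, y) = (1 - α) • p + α • q := by
    ext <;> simp [hx, hy]
  rwa [h2]

lemma tri_mem2 {S : Set (ℝ × ℝ)} (hS : Convex ℝ S) {p q r : ℝ × ℝ}
    (hp : p ∈ S) (hq : q ∈ S) (hr : r ∈ S) {x y : ℝ} (α β γ : ℝ)
    (hα : 0 ≤ α) (hβ : 0 ≤ β) (hγ : 0 ≤ γ)
    (h : α + β + γ = 1) (hx : x = α * p.1 + β * q.1 + γ * r.1)
    (hy : y = α * p.2 + β * q.2 + γ * r.2) : (x, y) ∈ S := by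
  have := tri_mem hS hp hq hr hα hβ hγ h
  have h2 : (x, y) = α • p + β • q + γ • r := by
    ext <;> simp [hx, hy]
  rwa [h2]

/-- a continuous nonvanishing function has constant sign on a preconnected set -/
lemma same_sign {X : Type*} [TopologicalSpace X] {K : Set X} (hK : IsPreconnected K) {g : X → ℝ}
    (hg : Continuous g) (hne : ∀ x ∈ K, g x ≠ 0) {x y : X} (hx : x ∈ K) (hy : y ∈ K) :
    0 < g x * g y := by
  by_contra hcon
  push Not at hcon
  have hI := (hK.image g hg.continuousOn).ordConnected
  rcases mul_nonpos_iff.1 hcon with h | h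
  · obtain ⟨z, hz, hz0⟩ := hI.out ⟨y, hy, rfl⟩ ⟨x, hx, rfl⟩ ⟨h.2, h.1⟩
    exact hne z hz hz0
  · obtain ⟨z, hz, hz0⟩ := hI.out ⟨x, hx, rfl⟩ ⟨y, hy, rfl⟩ ⟨h.1, h.2⟩
    exact hne z hz hz0

/-- The configuration in normalized coordinates: `e = (0,0)`, `a = (1,0)`, `b = (0,1)`. -/
structure Config (A B K K' W : Set (ℝ × ℝ)) (c d : ℝ × ℝ) : Prop where
  cA : Convex ℝ A
  cB : Convex ℝ B
  KA : K ⊆ A \ B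
  KB : K' ⊆ B \ A
  pK : IsPreconnected K
  pK' : IsPreconnected K'
  aK : ((1 : ℝ), (0 : ℝ)) ∈ K
  bK : ((0 : ℝ), (1 : ℝ)) ∈ K
  cK : c ∈ K'
  dK : d ∈ K'
  eA : ((0 : ℝ), (0 : ℝ)) ∈ A \ B
  hK : ∀ x ∈ K, ∃ l : ℝ, 0 ≤ l ∧ l ≤ 1 ∧ l • x ∈ B
  WA : ∀ x ∈ W, x ∉ A
  WB : ∀ x ∈ W, x ∉ B
  hac : ∀ s ∈ A ∩ B, ∀ x ∈ W, x ∉ convexHull ℝ {s, ((1 : ℝ), (0 : ℝ)), c}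
  hbd : ∀ s ∈ A ∩ B, ∀ x ∈ W, x ∉ convexHull ℝ {s, ((0 : ℝ), (1 : ℝ)), d}
  p : ∃ l : ℝ, 0 ≤ l ∧ l ≤ 1 ∧ (1 - l) • ((1 : ℝ), (0 : ℝ)) + l • d ∈ W
  q : ∃ l : ℝ, 0 ≤ l ∧ l ≤ 1 ∧ (1 - l) • ((0 : ℝ), (1 : ℝ)) + l • c ∈ W
  had : 0 ≤ (d.1 - 1 + d.2) * ((d.1 - 1) * c.2 - d.2 * (c.1 - 1))
  hbc : 0 ≤ (c.2 - 1 + c.1) * ((c.2 - 1) * d.1 - c.1 * (d.2 - 1))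

lemma preconn_swap {K : Set (ℝ × ℝ)} (h : IsPreconnected K) :
    IsPreconnected (Prod.swap ⁻¹' K) := by
  have := h.image Prod.swap continuous_swap.continuousOn
  rwa [Set.image_swap_eq_preimage_swap] at this

lemma convex_swap {K : Set (ℝ × ℝ)} (h : Convex ℝ K) : Convex ℝ (Prod.swap ⁻¹' K) := by
  intro x hx y hy a b ha hb hab
  exact h hx hy ha hb hab

lemma hull_swap {p q r x : ℝ × ℝ} (h : x ∈ convexHull ℝ {p, q, r}) :
    x.swap ∈ convexHull ℝ {p.swap, q.swap, r.swap} := by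
  have : convexHull ℝ {p, q, r} ⊆ Prod.swap ⁻¹' (convexHull ℝ {p.swap, q.swap, r.swap}) := by
    apply convexHull_min _ (convex_swap (convex_convexHull _ _))
    rintro y (rfl | rfl | rfl) <;> apply subset_convexHull <;> simp
  exact this h

lemma Config.swap {A B K K' W : Set (ℝ × ℝ)} {c d : ℝ × ℝ} (h : Config A B K K' W c d) :
    Config (Prod.swap ⁻¹' A) (Prod.swap ⁻¹' B) (Prod.swap ⁻¹' K) (Prod.swap ⁻¹' K')
      (Prod.swap ⁻¹' W) d.swap c.swap where
  cA := convex_swap h.cA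
  cB := convex_swap h.cB
  KA := fun x hx => h.KA hx
  KB := fun x hx => h.KB hx
  pK := preconn_swap h.pK
  pK' := preconn_swap h.pK'
  aK := h.bK
  bK := h.aK
  cK := by simpa using h.dK
  dK := by simpa using h.cK
  eA := h.eA
  hK := fun x hx => h.hK x.swap hx
  WA := fun x hx => h.WA _ hx
  WB := fun x hx => h.WB _ hx
  hac := fun s hs x hx hh => h.hbd s.swap hs x.swap hx (by simpa using hull_swap hh)
  hbd := fun s hs x hx hh => h.hac s.swap hs x.swap hx (by simpa using hull_swap hh)
  p := by
    obtain ⟨l, h0, h1, hl⟩ := h.q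
    exact ⟨l, h0, h1, by simpa using hl⟩
  q := by
    obtain ⟨l, h0, h1, hl⟩ := h.p
    exact ⟨l, h0, h1, by simpa using hl⟩
  had := by simpa using h.hbc
  hbc := by simpa using h.had

/-- `B` meets the segment from `e` to `b`. -/
lemma Config.tau {A B K K' W : Set (ℝ × ℝ)} {c d : ℝ × ℝ} (h : Config A B K K' W c d) :
    ∃ τ : ℝ, 0 < τ ∧ τ < 1 ∧ ((0 : ℝ), τ) ∈ B ∧ ((0 : ℝ), τ) ∈ A := by
  obtain ⟨l, h0, h1, hl⟩ := h.hK _ h.bK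
  have hl' : ((0 : ℝ), l) ∈ B := by simpa using hl
  refine ⟨l, lt_of_le_of_ne h0 ?_, lt_of_le_of_ne h1 ?_, hl', ?_⟩
  · rintro rfl; exact h.eA.2 hl'
  · rintro rfl; exact (h.KA h.bK).2 hl'
  · exact seg_mem2 h.cA h.eA.1 (h.KA h.bK).1 l h0 h1 (by simp) (by simp)

/-- `c`, `d` are on the same side of line `be`. -/
lemma Config.side {A B K K' W : Set (ℝ × ℝ)} {c d : ℝ × ℝ} (h : Config A B K K' W c d) :
    0 < c.1 * d.1 := by
  obtain ⟨τ, t0, t1, tB, tA⟩ := h.tau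
  refine same_sign h.pK' continuous_fst ?_ h.cK h.dK
  rintro ⟨x, y⟩ hx h0
  simp only at h0
  subst h0
  obtain ⟨xB, xA⟩ := h.KB hx
  rcases lt_or_ge y 0 with hy | hy
  · apply h.eA.2
    exact seg_mem2 h.cB tB xB (τ / (τ - y)) (by apply div_nonneg <;> linarith)
      (by rw [div_le_one] <;> linarith) (by simp)
      (by have : τ - y ≠ 0 := by linarith
          field_simp; ring)
  rcases le_or_gt y 1 with hy1 | hy1
  · apply xA
    exact seg_mem2 h.cA h.eA.1 (h.KA h.bK).1 y hy hy1 (by simp) (by simp)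
  · apply (h.KA h.bK).2
    exact seg_mem2 h.cB tB xB ((1 - τ) / (y - τ)) (by apply div_nonneg <;> linarith)
      (by rw [div_le_one] <;> linarith) (by simp)
      (by have : y - τ ≠ 0 := by linarith
          field_simp; ring)

/-- the wedge argument at `t = (0, τ)` -/
lemma Config.wedge {A B K K' W : Set (ℝ × ℝ)} {c d : ℝ × ℝ} (h : Config A B K K' W c d)
    {τ : ℝ} (t0 : 0 < τ) (t1 : τ < 1) (tB : ((0 : ℝ), τ) ∈ B) (tA : ((0 : ℝ), τ) ∈ A)
    {x : ℝ × ℝ} (hx : x ∈ K') (hx1 : 0 < x.1) : x.2 ≤ τ * (1 - x.1) := by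
  by_contra hcon
  push Not at hcon
  obtain ⟨xB, xA⟩ := h.KB hx
  let l : ℝ × ℝ → ℝ := fun z => (x.2 - τ) * z.1 - x.1 * (z.2 - τ)
  have hl : Continuous l := by fun_prop
  have o1 : IsOpen {z : ℝ × ℝ | 0 < z.1 ∧ 0 < l z} :=
    (isOpen_lt continuous_const continuous_fst).inter (isOpen_lt continuous_const hl)
  have o2 : IsOpen {z : ℝ × ℝ | z.1 < 0 ∨ l z < 0} :=
    (isOpen_lt continuous_fst continuous_const).union (isOpen_lt hl continuous_const)
  obtain ⟨z, hzK, hz1, hz2⟩ := h.pK _ _ o1 o2 (by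
    rintro ⟨u, v⟩ hz
    obtain ⟨zA, zB⟩ := h.KA hz
    by_contra hnot
    simp only [Set.mem_union, Set.mem_ofPred_eq, not_or, not_and, not_lt] at hnot
    obtain ⟨n1, n2, n3⟩ := hnot
    rcases n2.eq_or_lt with hu | hu
    · -- on the ray from t through e
      subst hu
      have hv : v ≤ τ := by
        have : 0 ≤ - (x.1 * (v - τ)) := by simpa [l] using n3
        by_contra hh
        push Not at hh
        have := mul_pos hx1 (sub_pos.2 hh)
        linarith
      obtain ⟨m, m0, m1, mB⟩ := h.hK _ hz
      have mB' : ((0 : ℝ), m * v) ∈ B := by simpa using mB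
      rcases le_or_gt v 0 with hv0 | hv0
      · apply h.eA.2
        have hmv : m * v ≤ 0 := mul_nonpos_of_nonneg_of_nonpos m0 hv0
        exact seg_mem2 h.cB tB mB' (τ / (τ - m * v)) (by apply div_nonneg <;> linarith)
          (by rw [div_le_one] <;> linarith) (by simp)
          (by have : τ - m * v ≠ 0 := by linarith
              field_simp; ring)
      · apply zB
        have hmv : m * v ≤ v := by nlinarith
        rcases eq_or_lt_of_le (hmv.trans hv) with hE | hE
        · have : v = τ := le_antisymm hv (by linarith)
          rw [this]; exact tB
        · exact seg_mem2 h.cB tB mB' ((τ - v) / (τ - m * v)) (by apply div_nonneg <;> linarith)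
            (by rw [div_le_one] <;> linarith) (by simp)
            (by have : τ - m * v ≠ 0 := by linarith
                generalize m * v = w at *
                field_simp; ring)
    · -- on the ray from t through x
      have hl0 : l (u, v) = 0 := le_antisymm (n1 hu) n3
      have hl1 : (x.2 - τ) * u - x.1 * (v - τ) = 0 := hl0
      rcases le_or_gt u x.1 with hux | hux
      · apply zB
        refine seg_mem2 h.cB tB xB (u / x.1) (by positivity) (by rwa [div_le_one hx1]) ?_ ?_
        · field_simp; ring
        · field_simp; linarith
      · apply xA
        refine seg_mem2 h.cA tA zA (x.1 / u) (by positivity) (by rw [div_le_one hu]; linarith) ?_ ?_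
        · field_simp; ring
        · field_simp; linarith)
    ⟨_, h.aK, by simp, by simp [l]; linarith⟩
    ⟨_, h.bK, Or.inr (by simp [l]; nlinarith)⟩
  simp only [Set.mem_ofPred_eq] at hz1 hz2
  rcases hz2 with h2 | h2 <;> linarith [hz1.1, hz1.2]

lemma Config.absurd_half {A B K K' W : Set (ℝ × ℝ)} {c d : ℝ × ℝ} (h : Config A B K K' W c d)
    (hc : 0 < c.1 ∨ c.2 < 0) : False := by
  obtain ⟨τ, t0, t1, tB, tA⟩ := h.tau
  obtain ⟨σ, s0, s1, sB, sA⟩ := h.swap.tau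
  simp only [Set.mem_preimage, Prod.swap_prod_mk] at sB sA
  have side1 := h.side
  have side2 := h.swap.side
  simp only [Prod.fst_swap] at side2
  have hcK := h.cK
  have hdK := h.dK
  obtain ⟨cB, cA⟩ := h.KB h.cK
  obtain ⟨dB, dA⟩ := h.KB h.dK
  obtain ⟨aA, aB⟩ := h.KA h.aK
  obtain ⟨bA, bB⟩ := h.KA h.bK
  obtain ⟨eA, eB⟩ := h.eA
  have wc := fun hx => h.wedge t0 t1 tB tA h.cK hx
  have wd := fun hx => h.wedge t0 t1 tB tA h.dK hx
  obtain ⟨lp, p0, p1, hp⟩ := h.p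
  obtain ⟨lq, q0, q1, hq⟩ := h.q
  have had := h.had
  have hac := h.hac _ ⟨sA, sB⟩
  have hbd := h.hbd _ ⟨tA, tB⟩
  obtain ⟨c1, c2⟩ := c
  obtain ⟨d1, d2⟩ := d
  simp only at *
  have hc1 : c1 ≠ 0 := by rintro rfl; simp at side1
  have hc2 : c2 ≠ 0 := by rintro rfl; simp at side2
  rcases hc2.lt_or_gt with hc2 | hc2
  swap
  · have hc1 : 0 < c1 := by rcases hc with h | h <;> linarith
    have := wc hc1
    apply cA
    have h1 : 0 < 1 - c1 := by
      by_contra hh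
      push Not at hh
      nlinarith
    exact tri_mem2 h.cA eA aA bA (1 - c1 - c2) c1 c2 (by nlinarith) hc1.le hc2.le (by ring)
      (by simp) (by simp)
  rcases hc1.lt_or_gt with hc1 | hc1
  · -- both negative: `e` is in the triangle `s t c`
    apply eB
    have hD : 0 < σ * τ - c1 * τ - c2 * σ := by nlinarith [mul_pos s0 t0]
    refine tri_mem2 h.cB sB tB cB (-c1 * τ / (σ * τ - c1 * τ - c2 * σ))
      (-c2 * σ / (σ * τ - c1 * τ - c2 * σ)) (σ * τ / (σ * τ - c1 * τ - c2 * σ))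
      ?_ ?_ ?_ ?_ ?_ ?_
    · apply div_nonneg _ hD.le; nlinarith
    · apply div_nonneg _ hD.le; nlinarith
    · apply div_nonneg _ hD.le; positivity
    · rw [← add_div, ← add_div, div_eq_one_iff_eq hD.ne']; ring
    · field_simp; ring
    · field_simp; ring
  have hd1 : 0 < d1 := by
    by_contra hh; push Not at hh; nlinarith
  have hd2 : d2 < 0 := by
    by_contra hh; push Not at hh; nlinarith
  have wc := wc hc1
  have wd := wd hd1
  -- `v`, the intersection of `bc` with the line `ae`
  have key : ∀ S : Set (ℝ × ℝ), Convex ℝ S → (c1, c2) ∈ S → (c1 / (1 - c2), (0 : ℝ)) ∈ S →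
      c1 / (1 - c2) ≤ 1 → (∀ x ∈ W, x ∉ S) → False := by
    intro S hS hcS hvS hv1 hWS
    have hvA : (c1 / (1 - c2), (0 : ℝ)) ∈ A :=
      seg_mem2 h.cA eA aA (c1 / (1 - c2)) (by apply div_nonneg <;> linarith) hv1 (by simp) (by simp)
    have hqe : (1 - lq) • ((0 : ℝ), (1 : ℝ)) + lq • (c1, c2) = (lq * c1, (1 - lq) + lq * c2) := by
      ext <;> simp
    rw [hqe] at hq
    have hne : 1 - c2 ≠ 0 := by linarith
    rcases le_total lq (1 / (1 - c2)) with hle | hle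
    · apply h.WA _ hq
      refine seg_mem2 h.cA bA hvA (lq * (1 - c2)) (by apply mul_nonneg <;> linarith) ?_ ?_ ?_
      · rwa [le_div_iff₀ (by linarith)] at hle
      · field_simp; ring
      · ring
    · apply hWS _ hq
      refine seg_mem2 hS hcS hvS ((1 - lq) * (1 - c2) / (-c2)) ?_ ?_ ?_ ?_
      · apply div_nonneg <;> nlinarith
      · rw [div_le_one (by linarith)]
        rw [div_le_iff₀ (by linarith)] at hle
        linarith
      · have : c2 ≠ 0 := hc2.ne
        field_simp; ring
      · have : c2 ≠ 0 := hc2.ne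
        field_simp; ring
  have hv0 : 0 < c1 / (1 - c2) := div_pos hc1 (by linarith)
  rcases le_or_gt (c1 / (1 - c2)) 1 with hv1 | hv1
  · rcases le_or_gt (c1 / (1 - c2)) σ with hvs | hvs
    · -- `v` in the triangle `s t c`
      refine key B h.cB cB ?_ hv1 h.WB
      have hm : (c1 * τ / (τ - c2), (0 : ℝ)) ∈ B := by
        have hne : τ - c2 ≠ 0 := by linarith
        refine seg_mem2 h.cB tB cB (τ / (τ - c2)) (by apply div_nonneg <;> linarith)
          (by rw [div_le_one] <;> linarith) ?_ ?_
        · field_simp; ring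
        · field_simp; ring
      have hmv : c1 * τ / (τ - c2) ≤ c1 / (1 - c2) := by
        rw [div_le_div_iff₀ (by linarith) (by linarith)]
        nlinarith [mul_pos hc1 (neg_pos.2 hc2), mul_pos (mul_pos hc1 (neg_pos.2 hc2)) (sub_pos.2 t1)]
      generalize c1 * τ / (τ - c2) = m at *
      generalize c1 / (1 - c2) = v at *
      rcases eq_or_lt_of_le (hmv.trans hvs) with hE | hE
      · have : v = σ := le_antisymm hvs (by linarith)
        rw [this]; exact sB
      · have : σ - m ≠ 0 := by linarith
        refine seg_mem2 h.cB hm sB ((v - m) / (σ - m)) (by apply div_nonneg <;> linarith)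
          (by rw [div_le_one] <;> linarith) ?_ (by simp)
        field_simp; ring
    · refine key _ (convex_convexHull ℝ _) (subset_convexHull ℝ _ (by simp)) ?_ hv1 hac
      refine seg_mem2 (convex_convexHull ℝ _) (p := (σ, 0)) (q := (1, 0))
        (subset_convexHull ℝ _ (by simp)) (subset_convexHull ℝ _ (by simp))
        ((c1 / (1 - c2) - σ) / (1 - σ)) (by apply div_nonneg <;> linarith)
          (by rw [div_le_one] <;> linarith) ?_ (by simp)
      have : 1 - σ ≠ 0 := by linarith
      generalize c1 / (1 - c2) = v
      field_simp; ring
  · rw [lt_div_iff₀ (by linarith)] at hv1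
    rcases le_or_gt 1 (d1 + d2) with hd | hd
    · apply hbd _ hp
      have hcv := convex_convexHull ℝ {((0 : ℝ), τ), ((0 : ℝ), (1 : ℝ)), (d1, d2)}
      have ha : ((1 : ℝ), (0 : ℝ)) ∈ convexHull ℝ {((0 : ℝ), τ), ((0 : ℝ), (1 : ℝ)), (d1, d2)} := by
        refine tri_mem2 hcv (p := (0, τ)) (q := (0, 1)) (r := (d1, d2))
          (subset_convexHull ℝ _ (by simp)) (subset_convexHull ℝ _ (by simp))
          (subset_convexHull ℝ _ (by simp)) ((d1 - 1 + d2) / (d1 * (1 - τ)))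
          ((-d2 - τ * (d1 - 1)) / (d1 * (1 - τ))) (1 / d1) ?_ ?_ ?_ ?_ ?_ ?_
        · apply div_nonneg
          · linarith
          · apply mul_nonneg <;> linarith
        · apply div_nonneg
          · linarith
          · apply mul_nonneg <;> linarith
        · positivity
        · have : 1 - τ ≠ 0 := by linarith
          field_simp; ring
        · field_simp; ring
        · have : 1 - τ ≠ 0 := by linarith
          field_simp; ring
      exact hcv ha (subset_convexHull ℝ _ (by simp)) (by linarith) p0 (by ring)
    · have h1 : 0 < (d1 - 1) * c2 - d2 * (c1 - 1) := by
        nlinarith [mul_pos (neg_pos.2 hc2) (show 0 < 1 - d1 - d2 by linarith),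
          mul_pos (neg_pos.2 hd2) (show 0 < c1 - 1 + c2 by linarith)]
      have h2 : d1 - 1 + d2 < 0 := by linarith
      nlinarith

lemma Config.absurd {A B K K' W : Set (ℝ × ℝ)} {c d : ℝ × ℝ} (h : Config A B K K' W c d) :
    False := by
  by_cases hc : 0 < c.1 ∨ c.2 < 0
  · exact h.absurd_half hc
  · push Not at hc
    refine h.swap.absurd_half ?_
    have h1 := h.side
    have h2 := h.swap.side
    simp only [Prod.fst_swap] at h2
    left
    simp only [Prod.fst_swap]
    by_contra hh
    push Not at hh
    nlinarith [hc.2]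
/-- twice the signed area -/
def crossDet (p q r : Plane) : ℝ := (q 0 - p 0) * (r 1 - p 1) - (q 1 - p 1) * (r 0 - p 0)

@[fun_prop]
lemma continuous_crossDet (p q : Plane) : Continuous (fun x => crossDet p q x) := by
  unfold crossDet; fun_prop

lemma crossDet_sum (p q r x : Plane) :
    crossDet q r x + crossDet r p x + crossDet p q x = crossDet p q r := by
  unfold crossDet; ring

/-- barycentric representation -/
lemma bary {p q r : Plane} (h : crossDet p q r ≠ 0) (x : Plane) :
    x = (crossDet q r x / crossDet p q r) • p + (crossDet r p x / crossDet p q r) • q +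
      (crossDet p q x / crossDet p q r) • r := by
  ext i
  fin_cases i
  · simp
    field_simp
    unfold crossDet; ring
  · simp
    field_simp
    unfold crossDet; ring

lemma mem_tri_of_pos {p q r x : Plane} (h : 0 < crossDet p q r) (h1 : 0 ≤ crossDet q r x)
    (h2 : 0 ≤ crossDet r p x) (h3 : 0 ≤ crossDet p q x) : x ∈ convexHull ℝ {p, q, r} := by
  rw [bary h.ne' x]
  apply tri_mem (convex_convexHull ℝ _) (subset_convexHull ℝ _ (by simp))
    (subset_convexHull ℝ _ (by simp)) (subset_convexHull ℝ _ (by simp))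
  · positivity
  · positivity
  · positivity
  · rw [← add_div, ← add_div, crossDet_sum, div_self h.ne']

lemma crossDet_tri (p q r : Plane) (α β γ : ℝ) (h : α + β + γ = 1) :
    crossDet p q (α • p + β • q + γ • r) = γ * crossDet p q r := by
  obtain rfl : α = 1 - β - γ := by linarith
  simp [crossDet]; ring

lemma crossDet_tri1 (p q r : Plane) (α β γ : ℝ) (h : α + β + γ = 1) :
    crossDet q r (α • p + β • q + γ • r) = α * crossDet p q r := by
  obtain rfl : α = 1 - β - γ := by linarith
  simp [crossDet]; ring

lemma crossDet_tri2 (p q r : Plane) (α β γ : ℝ) (h : α + β + γ = 1) :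
    crossDet r p (α • p + β • q + γ • r) = β * crossDet p q r := by
  obtain rfl : α = 1 - β - γ := by linarith
  simp [crossDet]; ring

lemma mem_tri_iff {p q r x : Plane} : x ∈ convexHull ℝ {p, q, r} ↔
    ∃ α β γ : ℝ, 0 ≤ α ∧ 0 ≤ β ∧ 0 ≤ γ ∧ α + β + γ = 1 ∧ α • p + β • q + γ • r = x := by
  constructor
  · intro h
    rw [convexHull_insert (by simp)] at h
    simp only [convexHull_pair, mem_convexJoin, Set.mem_singleton_iff, exists_eq_left] at h
    obtain ⟨y, ⟨a, b, ha, hb, hab, rfl⟩, ⟨u, v, hu, hv, huv, rfl⟩⟩ := h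
    refine ⟨u, v * a, v * b, hu, by positivity, by positivity, ?_, ?_⟩
    · rw [add_assoc, ← mul_add, hab, mul_one, huv]
    · module
  · rintro ⟨α, β, γ, h1, h2, h3, h4, rfl⟩
    exact tri_mem (convex_convexHull ℝ _) (subset_convexHull ℝ _ (by simp))
      (subset_convexHull ℝ _ (by simp)) (subset_convexHull ℝ _ (by simp)) h1 h2 h3 h4

lemma crossDet_swap (p q r : Plane) : crossDet q p r = - crossDet p q r := by
  unfold crossDet; ring

lemma collinear_of_crossDet {p q r : Plane} (h : crossDet p q r = 0) :
    Collinear ℝ ({p, q, r} : Set Plane) := by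
  by_cases hpq : p = q
  · subst hpq
    simpa using collinear_pair ℝ p r
  rw [collinear_iff_of_mem (p₀ := p) (by simp)]
  refine ⟨q - p, ?_⟩
  have hne : (q 0 - p 0) ^ 2 + (q 1 - p 1) ^ 2 ≠ 0 := by
    intro h0
    apply hpq
    have h1 : q 0 - p 0 = 0 := by nlinarith [sq_nonneg (q 0 - p 0), sq_nonneg (q 1 - p 1)]
    have h2 : q 1 - p 1 = 0 := by nlinarith [sq_nonneg (q 0 - p 0), sq_nonneg (q 1 - p 1)]
    ext i; fin_cases i
    · simp; linarith
    · simp; linarith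
  rintro x (rfl | rfl | rfl)
  · exact ⟨0, by simp⟩
  · exact ⟨1, by simp⟩
  · refine ⟨((x 0 - p 0) * (q 0 - p 0) + (x 1 - p 1) * (q 1 - p 1)) /
      ((q 0 - p 0) ^ 2 + (q 1 - p 1) ^ 2), ?_⟩
    unfold crossDet at h
    ext i; fin_cases i
    · simp
      field_simp
      linear_combination (-(q 1 - p 1)) * h
    · simp
      field_simp
      linear_combination (q 0 - p 0) * h

/-- A preconnected unbounded set avoiding the frontier of a bounded set avoids the set. -/
lemma avoid_of_frontier {W T : Set Plane} (hW : IsPreconnected W) (hub : ¬ Bornology.IsBounded W)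
    (hT : Bornology.IsBounded T) (hf : ∀ x ∈ T, x ∈ W → x ∈ interior T)
    (hcl : IsClosed T) : Disjoint W T := by
  rw [Set.disjoint_iff_inter_eq_empty]
  by_contra hne
  have hne : (W ∩ T).Nonempty := Set.nonempty_iff_ne_empty.2 hne
  have hne2 : (W ∩ Tᶜ).Nonempty := by
    by_contra hh
    apply hub
    apply hT.subset
    intro x hx
    by_contra hxT
    exact hh ⟨x, hx, hxT⟩
  have hcov : W ⊆ interior T ∪ Tᶜ := by
    intro x hx
    by_cases hxT : x ∈ T
    · exact Or.inl (hf x hxT hx)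
    · exact Or.inr hxT
  obtain ⟨x, hx, hxT⟩ := hne
  obtain ⟨z, _, hz1, hz2⟩ := hW _ _ isOpen_interior hcl.isOpen_compl hcov ⟨x, hx, hf x hxT hx⟩ hne2
  exact hz2 (interior_subset hz1)

lemma tri_compact (p q r : Plane) : IsCompact (convexHull ℝ {p, q, r}) :=
  Set.Finite.isCompact_convexHull ℝ (by simp)

/-- points of the triangle are on a side or in the interior -/
lemma tri_cases {p q r x : Plane} (h : 0 < crossDet p q r) (hx : x ∈ convexHull ℝ {p, q, r}) :
    x ∈ segment ℝ p q ∨ x ∈ segment ℝ q r ∨ x ∈ segment ℝ p r ∨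
      (0 < crossDet q r x ∧ 0 < crossDet r p x ∧ 0 < crossDet p q x) := by
  obtain ⟨α, β, γ, h1, h2, h3, h4, rfl⟩ := mem_tri_iff.1 hx
  rw [crossDet_tri1 _ _ _ _ _ _ h4, crossDet_tri2 _ _ _ _ _ _ h4, crossDet_tri _ _ _ _ _ _ h4]
  rcases h1.eq_or_lt with e | e
  · right; left
    exact ⟨β, γ, h2, h3, by linarith, by simp [← e]⟩
  rcases h2.eq_or_lt with e' | e'
  · right; right; left
    exact ⟨α, γ, h1, h3, by linarith, by simp [← e']⟩
  rcases h3.eq_or_lt with e'' | e''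
  · left
    exact ⟨α, β, h1, h2, by linarith, by simp [← e'']⟩
  right; right; right
  refine ⟨by positivity, by positivity, by positivity⟩

lemma tri_interior {p q r x : Plane} (h : 0 < crossDet p q r)
    (hx : 0 < crossDet q r x ∧ 0 < crossDet r p x ∧ 0 < crossDet p q x) :
    x ∈ interior (convexHull ℝ {p, q, r}) := by
  refine mem_interior.2 ⟨{y | 0 < crossDet q r y ∧ 0 < crossDet r p y ∧ 0 < crossDet p q y}, ?_, ?_,
    hx⟩
  · rintro y ⟨h1, h2, h3⟩
    exact mem_tri_of_pos h h1.le h2.le h3.le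
  · exact (isOpen_lt continuous_const (continuous_crossDet _ _)).inter
      ((isOpen_lt continuous_const (continuous_crossDet _ _)).inter
      (isOpen_lt continuous_const (continuous_crossDet _ _)))

lemma avoid_tri_pos {W : Set Plane} (hW : IsPreconnected W) (hub : ¬ Bornology.IsBounded W)
    {p q r : Plane} (h : 0 < crossDet p q r)
    (h1 : Disjoint W (segment ℝ p q)) (h2 : Disjoint W (segment ℝ q r))
    (h3 : Disjoint W (segment ℝ p r)) : Disjoint W (convexHull ℝ {p, q, r}) := by
  apply avoid_of_frontier hW hub (tri_compact _ _ _).isBounded _ (tri_compact _ _ _).isClosed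
  intro x hx hxW
  rcases tri_cases h hx with hs | hs | hs | hs
  · exact (Set.disjoint_left.1 h1 hxW hs).elim
  · exact (Set.disjoint_left.1 h2 hxW hs).elim
  · exact (Set.disjoint_left.1 h3 hxW hs).elim
  · exact tri_interior h hs

lemma hull_sub_seg {p q r : Plane} (h : Wbtw ℝ p q r) :
    convexHull ℝ {p, q, r} ⊆ segment ℝ p r := by
  apply convexHull_min _ (convex_segment _ _)
  rintro x (rfl | rfl | rfl)
  · exact left_mem_segment _ _ _
  · exact h.mem_segment
  · exact right_mem_segment _ _ _

/-- Triangle lemma -/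
lemma avoid_tri {W : Set Plane} (hW : IsPreconnected W) (hub : ¬ Bornology.IsBounded W)
    {p q r : Plane}
    (h1 : Disjoint W (segment ℝ p q)) (h2 : Disjoint W (segment ℝ q r))
    (h3 : Disjoint W (segment ℝ p r)) : Disjoint W (convexHull ℝ {p, q, r}) := by
  rcases lt_trichotomy (crossDet p q r) 0 with h | h | h
  · have h' : 0 < crossDet q p r := by rw [crossDet_swap]; linarith
    have := avoid_tri_pos hW hub h' (by rwa [segment_symm]) h3 h2
    rwa [Set.insert_comm] at this
  · rcases (collinear_of_crossDet h).wbtw_or_wbtw_or_wbtw with hw | hw | hw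
    · exact h3.mono_right (hull_sub_seg hw)
    · have := hull_sub_seg hw
      rw [segment_symm] at this
      refine h1.mono_right (subset_trans (le_of_eq ?_) this)
      congr 1; ext; simp; tauto
    · have := hull_sub_seg hw
      rw [segment_symm] at this
      refine h2.mono_right (subset_trans (le_of_eq ?_) this)
      congr 1; ext; simp; tauto
  · exact avoid_tri_pos hW hub h h1 h2 h3

/-- Quadrilateral lemma: `b` and `c` strictly on opposite sides of `ad`. -/
lemma avoid_diag_pos {W : Set Plane} (hW : IsPreconnected W) (hub : ¬ Bornology.IsBounded W)
    {a b c d : Plane} (hb : 0 < crossDet a d b) (hc : crossDet a d c < 0)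
    (h1 : Disjoint W (segment ℝ a b)) (h2 : Disjoint W (segment ℝ b d))
    (h3 : Disjoint W (segment ℝ a c)) (h4 : Disjoint W (segment ℝ c d)) :
    Disjoint W (segment ℝ a d) := by
  have hc' : 0 < crossDet d a c := by rw [crossDet_swap]; linarith
  have hsub : segment ℝ a d ⊆ convexHull ℝ {a, d, b} ∪ convexHull ℝ {d, a, c} := by
    refine subset_trans ?_ Set.subset_union_left
    exact segment_subset_convexHull (by simp) (by simp)
  refine Disjoint.mono_right hsub ?_
  apply avoid_of_frontier hW hub
    ((tri_compact _ _ _).isBounded.union (tri_compact _ _ _).isBounded) _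
    ((tri_compact _ _ _).isClosed.union (tri_compact _ _ _).isClosed)
  have hopen : IsOpen {y | 0 < crossDet d b y ∧ 0 < crossDet b a y ∧ 0 < crossDet a c y ∧
      0 < crossDet c d y} :=
    (isOpen_lt continuous_const (continuous_crossDet _ _)).inter
      ((isOpen_lt continuous_const (continuous_crossDet _ _)).inter
      ((isOpen_lt continuous_const (continuous_crossDet _ _)).inter
      (isOpen_lt continuous_const (continuous_crossDet _ _))))
  have hsegad : ∀ x ∈ segment ℝ a d, x ∈ W →
      x ∈ interior (convexHull ℝ {a, d, b} ∪ convexHull ℝ {d, a, c}) := by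
    intro x hx hxW
    obtain ⟨α, β, hα, hβ, hαβ, rfl⟩ := hx
    have hα' : 0 < α := by
      rcases hα.eq_or_lt with e | e
      · exfalso
        apply Set.disjoint_left.1 h2 hxW
        have : β = 1 := by linarith
        simp only [← e, this, zero_smul, one_smul, zero_add]
        exact right_mem_segment _ _ _
      · exact e
    have hβ' : 0 < β := by
      rcases hβ.eq_or_lt with e | e
      · exfalso
        apply Set.disjoint_left.1 h1 hxW
        have : α = 1 := by linarith
        simp only [← e, this, zero_smul, one_smul, add_zero]
        exact left_mem_segment _ _ _
      · exact e
    obtain rfl : β = 1 - α := by linarith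
    refine mem_interior.2 ⟨_, ?_, hopen, ?_⟩
    · rintro y ⟨g1, g2, g3, g4⟩
      rcases le_total 0 (crossDet a d y) with hy | hy
      · exact Or.inl (mem_tri_of_pos hb g1.le g2.le hy)
      · refine Or.inr (mem_tri_of_pos hc' g3.le g4.le ?_)
        rw [crossDet_swap]; linarith
    · have e1 : crossDet d b (α • a + (1 - α) • d) = α * crossDet a d b := by
        simp [crossDet]; ring
      have e2 : crossDet b a (α • a + (1 - α) • d) = (1 - α) * crossDet a d b := by
        simp [crossDet]; ring
      have e3 : crossDet a c (α • a + (1 - α) • d) = (1 - α) * crossDet d a c := by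
        simp [crossDet]; ring
      have e4 : crossDet c d (α • a + (1 - α) • d) = α * crossDet d a c := by
        simp [crossDet]; ring
      refine ⟨?_, ?_, ?_, ?_⟩
      · rw [e1]; positivity
      · rw [e2]; positivity
      · rw [e3]; positivity
      · rw [e4]; positivity
  rintro x (hx | hx) hxW
  · rcases tri_cases hb hx with hs | hs | hs | hs
    · exact hsegad x hs hxW
    · exact (Set.disjoint_left.1 h2 hxW (by rwa [segment_symm])).elim
    · exact (Set.disjoint_left.1 h1 hxW hs).elim
    · exact interior_mono Set.subset_union_left (tri_interior hb hs)
  · rcases tri_cases hc' hx with hs | hs | hs | hs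
    · exact hsegad x (by rwa [segment_symm]) hxW
    · exact (Set.disjoint_left.1 h3 hxW hs).elim
    · exact (Set.disjoint_left.1 h4 hxW (by rwa [segment_symm])).elim
    · exact interior_mono Set.subset_union_right (tri_interior hc' hs)

lemma avoid_diag {W : Set Plane} (hW : IsPreconnected W) (hub : ¬ Bornology.IsBounded W)
    {a b c d : Plane} (hbc : crossDet a d b * crossDet a d c < 0)
    (h1 : Disjoint W (segment ℝ a b)) (h2 : Disjoint W (segment ℝ b d))
    (h3 : Disjoint W (segment ℝ a c)) (h4 : Disjoint W (segment ℝ c d)) :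
    Disjoint W (segment ℝ a d) := by
  rcases mul_neg_iff.1 hbc with h | h
  · exact avoid_diag_pos hW hub h.1 h.2 h1 h2 h3 h4
  · exact avoid_diag_pos hW hub h.2 h.1 h3 h4 h1 h2

/-- Avoiding all segments of a finite set means avoiding its convex hull. -/
lemma avoid_hull {W : Set Plane} (hW : IsPreconnected W) (hub : ¬ Bornology.IsBounded W)
    {S : Set Plane} (hS : ∀ p ∈ S, ∀ q ∈ S, Disjoint W (segment ℝ p q)) :
    Disjoint W (convexHull ℝ S) := by
  rw [Set.disjoint_left]
  intro x hxW hx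
  rw [convexHull_eq_union] at hx
  simp only [Set.mem_iUnion] at hx
  obtain ⟨t, htS, hind, hxt⟩ := hx
  have hcard : t.card ≤ 3 := by
    have := hind.card_le_finrank_succ
    have h2 := Submodule.finrank_le (vectorSpan ℝ (Set.range ((↑) : t → Plane)))
    simp at this h2
    omega
  have htri : ∀ p ∈ S, ∀ q ∈ S, ∀ r ∈ S, x ∉ convexHull ℝ {p, q, r} := by
    intro p hp q hq r hr
    exact Set.disjoint_left.1 (avoid_tri hW hub (hS p hp q hq) (hS q hq r hr) (hS p hp r hr)) hxW
  have h4 : t.card = 0 ∨ t.card = 1 ∨ t.card = 2 ∨ t.card = 3 := by omega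
  rcases h4 with h | h | h | h
  · rw [Finset.card_eq_zero] at h
    subst h
    simp at hxt
  · obtain ⟨p, rfl⟩ := Finset.card_eq_one.1 h
    have hp : p ∈ S := htS (by simp)
    exact htri p hp p hp p hp (by simpa using hxt)
  · obtain ⟨p, q, _, rfl⟩ := Finset.card_eq_two.1 h
    have hp : p ∈ S := htS (by simp)
    have hq : q ∈ S := htS (by simp)
    exact htri p hp p hp q hq (by simpa using hxt)
  · obtain ⟨p, q, r, _, _, _, rfl⟩ := Finset.card_eq_three.1 h
    have hp : p ∈ S := htS (by simp)
    have hq : q ∈ S := htS (by simp)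
    have hr : r ∈ S := htS (by simp)
    exact htri p hp q hq r hr (by simpa using hxt)
/-- affine coordinates with origin `e` and basis `a - e`, `b - e` -/
def affChart (e a b : Plane) (z : ℝ × ℝ) : Plane := e + z.1 • (a - e) + z.2 • (b - e)

def affInv (e a b : Plane) (x : Plane) : ℝ × ℝ :=
  (crossDet e x b / crossDet e a b, crossDet e a x / crossDet e a b)

lemma affChart_inv {e a b : Plane} (h : crossDet e a b ≠ 0) (x : Plane) :
    affChart e a b (affInv e a b x) = x := by
  ext i
  fin_cases i
  · simp [affChart, affInv]
    field_simp
    unfold crossDet; ring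
  · simp [affChart, affInv]
    field_simp
    unfold crossDet; ring

lemma affInv_chart {e a b : Plane} (h : crossDet e a b ≠ 0) (z : ℝ × ℝ) :
    affInv e a b (affChart e a b z) = z := by
  ext
  · simp only [affInv]
    rw [div_eq_iff h]
    simp [affChart, crossDet]; ring
  · simp only [affInv]
    rw [div_eq_iff h]
    simp [affChart, crossDet]; ring

lemma continuous_affInv (e a b : Plane) : Continuous (affInv e a b) := by
  unfold affInv crossDet
  fun_prop

lemma affChart_comb (e a b : Plane) (x y : ℝ × ℝ) (α β : ℝ) (h : α + β = 1) :
    affChart e a b (α • x + β • y) = α • affChart e a b x + β • affChart e a b y := by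
  obtain rfl : α = 1 - β := by linarith
  simp [affChart]; module

lemma convex_affChart (e a b : Plane) {S : Set Plane} (hS : Convex ℝ S) :
    Convex ℝ (affChart e a b ⁻¹' S) := by
  intro x hx y hy α β hα hβ h
  rw [Set.mem_preimage, affChart_comb _ _ _ _ _ _ _ h]
  exact hS hx hy hα hβ h

lemma preconn_affChart {e a b : Plane} (h : crossDet e a b ≠ 0) {S : Set Plane}
    (hS : IsPreconnected S) : IsPreconnected (affChart e a b ⁻¹' S) := by
  have h1 := hS.image _ (continuous_affInv e a b).continuousOn
  convert h1 using 1
  ext z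
  constructor
  · intro hz
    exact ⟨_, hz, affInv_chart h z⟩
  · rintro ⟨x, hx, rfl⟩
    rw [Set.mem_preimage, affChart_inv h]; exact hx

lemma hull_affChart {e a b : Plane} {p q r x : ℝ × ℝ} (h : x ∈ convexHull ℝ {p, q, r}) :
    affChart e a b x ∈
      convexHull ℝ {affChart e a b p, affChart e a b q, affChart e a b r} := by
  have : convexHull ℝ {p, q, r} ⊆ affChart e a b ⁻¹'
      (convexHull ℝ {affChart e a b p, affChart e a b q, affChart e a b r}) := by
    apply convexHull_min _ (convex_affChart _ _ _ (convex_convexHull _ _))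
    rintro y (rfl | rfl | rfl) <;> apply subset_convexHull <;> simp
  exact this h

lemma crossDet_affChart (e a b : Plane) (x y z : ℝ × ℝ) :
    crossDet (affChart e a b x) (affChart e a b y) (affChart e a b z) =
      ((y.1 - x.1) * (z.2 - x.2) - (y.2 - x.2) * (z.1 - x.1)) * crossDet e a b := by
  simp [affChart, crossDet]; ring

lemma plane_core {A B K K' W : Set Plane} {a b c d e : Plane}
    (hgp : crossDet e a b ≠ 0)
    (cA : Convex ℝ A) (cB : Convex ℝ B) (KA : K ⊆ A \ B) (KB : K' ⊆ B \ A)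
    (pK : IsPreconnected K) (pK' : IsPreconnected K') (aK : a ∈ K) (bK : b ∈ K)
    (cK : c ∈ K') (dK : d ∈ K') (eA : e ∈ A \ B)
    (hK : ∀ x ∈ K, (segment ℝ e x ∩ B).Nonempty)
    (pW : IsPreconnected W) (hub : ¬ Bornology.IsBounded W)
    (WA : Disjoint W A) (WB : Disjoint W B)
    (hac : Disjoint W (segment ℝ a c)) (hbd : Disjoint W (segment ℝ b d))
    (hp : (segment ℝ a d ∩ W).Nonempty) (hq : (segment ℝ b c ∩ W).Nonempty) : False := by
  have ha : affChart e a b (1, 0) = a := by simp [affChart]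
  have hb : affChart e a b (0, 1) = b := by simp [affChart]
  have he : affChart e a b (0, 0) = e := by simp [affChart]
  have hc : affChart e a b (affInv e a b c) = c := affChart_inv hgp c
  have hd : affChart e a b (affInv e a b d) = d := affChart_inv hgp d
  have aA := (KA aK).1
  have bA := (KA bK).1
  have cB' := (KB cK).1
  have dB := (KB dK).1
  have wab : Disjoint W (segment ℝ a b) := WA.mono_right (cA.segment_subset aA bA)
  have wcd : Disjoint W (segment ℝ c d) := WB.mono_right (cB.segment_subset cB' dB)
  have hsq : 0 < crossDet e a b * crossDet e a b := mul_self_pos.2 hgp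
  refine Config.absurd (A := affChart e a b ⁻¹' A) (B := affChart e a b ⁻¹' B)
    (K := affChart e a b ⁻¹' K) (K' := affChart e a b ⁻¹' K') (W := affChart e a b ⁻¹' W)
    (c := affInv e a b c) (d := affInv e a b d) ?_
  refine
    { cA := convex_affChart _ _ _ cA
      cB := convex_affChart _ _ _ cB
      KA := fun x hx => KA hx
      KB := fun x hx => KB hx
      pK := preconn_affChart hgp pK
      pK' := preconn_affChart hgp pK'
      aK := by rw [Set.mem_preimage, ha]; exact aK
      bK := by rw [Set.mem_preimage, hb]; exact bK
      cK := by rw [Set.mem_preimage, hc]; exact cK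
      dK := by rw [Set.mem_preimage, hd]; exact dK
      eA := by
        rw [← Set.preimage_sdiff, Set.mem_preimage, he]; exact eA
      hK := ?_
      WA := fun x hx hx' => Set.disjoint_left.1 WA hx hx'
      WB := fun x hx hx' => Set.disjoint_left.1 WB hx hx'
      hac := ?_
      hbd := ?_
      p := ?_
      q := ?_
      had := ?_
      hbc := ?_ }
  · intro x hx
    obtain ⟨y, ⟨α, β, hα, hβ, hαβ, rfl⟩, hy⟩ := hK _ hx
    refine ⟨β, hβ, by linarith, ?_⟩
    have := affChart_comb e a b (0, 0) x α β hαβ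
    rw [he] at this
    rw [← this] at hy
    have h0 : α • ((0 : ℝ), (0 : ℝ)) + β • x = β • x := by ext <;> simp
    rwa [h0] at hy
  · rintro s ⟨sA, sB⟩ x hx hh
    have h1 := hull_affChart (e := e) (a := a) (b := b) hh
    rw [ha, hc] at h1
    refine Set.disjoint_left.1 (avoid_tri pW hub ?_ hac ?_) hx h1
    · exact WA.mono_right (cA.segment_subset sA aA)
    · exact WB.mono_right (cB.segment_subset sB cB')
  · rintro s ⟨sA, sB⟩ x hx hh
    have h1 := hull_affChart (e := e) (a := a) (b := b) hh
    rw [hb, hd] at h1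
    refine Set.disjoint_left.1 (avoid_tri pW hub ?_ hbd ?_) hx h1
    · exact WA.mono_right (cA.segment_subset sA bA)
    · exact WB.mono_right (cB.segment_subset sB dB)
  · obtain ⟨y, ⟨α, β, hα, hβ, hαβ, rfl⟩, hy⟩ := hp
    refine ⟨β, hβ, by linarith, ?_⟩
    rw [Set.mem_preimage, affChart_comb _ _ _ _ _ _ _ (by ring), ha, hd]
    rwa [show 1 - β = α by linarith]
  · obtain ⟨y, ⟨α, β, hα, hβ, hαβ, rfl⟩, hy⟩ := hq
    refine ⟨β, hβ, by linarith, ?_⟩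
    rw [Set.mem_preimage, affChart_comb _ _ _ _ _ _ _ (by ring), hb, hc]
    rwa [show 1 - β = α by linarith]
  · by_contra hneg
    push Not at hneg
    obtain ⟨y, hy1, hy2⟩ := hp
    refine Set.disjoint_left.1 (avoid_diag pW hub (b := b) (c := c) ?_ wab hbd hac wcd) hy2 hy1
    have e1 := crossDet_affChart e a b (1, 0) (affInv e a b d) (0, 1)
    have e2 := crossDet_affChart e a b (1, 0) (affInv e a b d) (affInv e a b c)
    rw [ha, hb, hd] at e1
    rw [ha, hc, hd] at e2
    rw [e1, e2]
    simp only
    nlinarith [mul_pos hsq (neg_pos.2 hneg)]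
  · by_contra hneg
    push Not at hneg
    obtain ⟨y, hy1, hy2⟩ := hq
    refine Set.disjoint_left.1 (avoid_diag pW hub (b := a) (c := d) ?_ (by rwa [segment_symm]) hac
      hbd (by rwa [segment_symm])) hy2 hy1
    have e1 := crossDet_affChart e a b (0, 1) (affInv e a b c) (1, 0)
    have e2 := crossDet_affChart e a b (0, 1) (affInv e a b c) (affInv e a b d)
    rw [ha, hb, hc] at e1
    rw [hb, hc, hd] at e2
    rw [e1, e2]
    simp only
    nlinarith [mul_pos hsq (neg_pos.2 hneg)]

/-- Another component of `CH(S) \ B` contains a point of `S`. -/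
lemma exists_vertex {S B : Set Plane} (cB : Convex ℝ B) (clB : IsClosed B)
    {e₀ : Plane} (he₀ : e₀ ∈ convexHull ℝ S \ B) :
    ∃ e ∈ S, segment ℝ e₀ e ⊆ convexHull ℝ S \ B := by
  obtain ⟨l, u, h1, h2⟩ := geometric_hahn_banach_closed_point cB clB he₀.2
  have hex : ∃ e ∈ S, u < l e := by
    by_contra hcon
    push Not at hcon
    have : convexHull ℝ S ⊆ {x | l x ≤ u} :=
      convexHull_min hcon (convex_halfSpace_le l.toLinearMap.isLinear u)
    have h3 : l e₀ ≤ u := this he₀.1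
    linarith
  obtain ⟨e, heS, he⟩ := hex
  refine ⟨e, heS, fun x hx => ⟨(convex_convexHull ℝ S).segment_subset he₀.1
    (subset_convexHull ℝ S heS) hx, fun hxB => ?_⟩⟩
  have h3 : x ∈ {x | u < l x} :=
    (convex_halfSpace_gt l.toLinearMap.isLinear u).segment_subset h2 he hx
  have h4 := h1 x hxB
  have h5 : u < l x := h3
  linarith

lemma collinear_crossDet {p q r : Plane} (h : ¬ Collinear ℝ ({p, q, r} : Set Plane)) :
    crossDet p q r ≠ 0 := fun h0 => h (collinear_of_crossDet h0)

/-- In an outside-obstacle representation with cliques `Z, Z'` whose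
convex hulls are exactly 1-crossing, for every induced 4-cycle `z₁ z₁' z₂' z₂` with
`z₁, z₂ ∈ Z` and `z₁', z₂' ∈ Z'`, either `f z₁, f z₂` lie in different petals of `Z` or
`f z₁', f z₂'` lie in different petals of `Z'`. -/
theorem induced_fourCycle_different_petals
    {V : Type} [Fintype V] (G : SimpleGraph V) (f : V → Plane) (C : Set Plane)
    (hrep : IsOutsideObstacleRep G f C) (Z Z' : Set V)
    (hZ : Z.Pairwise G.Adj) (hZ' : Z'.Pairwise G.Adj)
    (z₁ z₂ z₁' z₂' : V)
    (hz₁ : z₁ ∈ Z) (hz₂ : z₂ ∈ Z) (hz₁' : z₁' ∈ Z') (hz₂' : z₂' ∈ Z')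
    (hdistinct : [z₁, z₂, z₁', z₂'].Pairwise (· ≠ ·))
    (he₁ : G.Adj z₁ z₁') (he₂ : G.Adj z₁' z₂') (he₃ : G.Adj z₂' z₂) (he₄ : G.Adj z₂ z₁)
    (hn₁ : ¬ G.Adj z₁ z₂') (hn₂ : ¬ G.Adj z₂ z₁')
    (hcross : ExactlyCrossing (f '' Z) (f '' Z') 1) :
    (f z₁ ∈ convexHull ℝ (f '' Z) \ convexHull ℝ (f '' Z') ∧
     f z₂ ∈ convexHull ℝ (f '' Z) \ convexHull ℝ (f '' Z') ∧
     connectedComponentIn (convexHull ℝ (f '' Z) \ convexHull ℝ (f '' Z')) (f z₁) ≠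
       connectedComponentIn (convexHull ℝ (f '' Z) \ convexHull ℝ (f '' Z')) (f z₂)) ∨
    (f z₁' ∈ convexHull ℝ (f '' Z') \ convexHull ℝ (f '' Z) ∧
     f z₂' ∈ convexHull ℝ (f '' Z') \ convexHull ℝ (f '' Z) ∧
     connectedComponentIn (convexHull ℝ (f '' Z') \ convexHull ℝ (f '' Z)) (f z₁') ≠
       connectedComponentIn (convexHull ℝ (f '' Z') \ convexHull ℝ (f '' Z)) (f z₂')) := by
  obtain ⟨⟨hinj, hgen, hCo, hCc, hCd, hadj⟩, hCU⟩ := hrep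
  simp only [List.pairwise_cons, List.mem_cons, List.not_mem_nil, or_false, forall_eq_or_imp,
    forall_eq] at hdistinct
  obtain ⟨⟨d12, d11', d12'⟩, ⟨d21', d22'⟩, d1'2', -⟩ := hdistinct
  have hp : (segment ℝ (f z₁) (f z₂') ∩ C).Nonempty :=
    Set.not_disjoint_iff_nonempty_inter.1 (fun h => hn₁ ((hadj _ _ d12').2 h))
  have hq : (segment ℝ (f z₂) (f z₁') ∩ C).Nonempty :=
    Set.not_disjoint_iff_nonempty_inter.1 (fun h => hn₂ ((hadj _ _ d21').2 h))
  obtain ⟨p, hpC⟩ := hCc.nonempty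
  obtain ⟨W, hWdef⟩ : ∃ W, W = connectedComponentIn (edgeUnion G f)ᶜ p := ⟨_, rfl⟩
  have pW : IsPreconnected W := hWdef ▸ isPreconnected_connectedComponentIn
  have hub : ¬ Bornology.IsBounded W := hWdef ▸ (hCU hpC).2
  have hWE : W ⊆ (edgeUnion G f)ᶜ := hWdef ▸ connectedComponentIn_subset _ _
  have hCW : C ⊆ W := by
    rw [hWdef]
    exact hCc.isPreconnected.subset_connectedComponentIn hpC (fun x hx => (hCU hx).1)
  have hedge : ∀ u v, G.Adj u v → Disjoint W (segment ℝ (f u) (f v)) := by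
    intro u v huv
    rw [Set.disjoint_left]
    intro x hxW hx
    apply hWE hxW
    simp only [edgeUnion, Set.mem_iUnion]
    exact ⟨u, v, huv, hx⟩
  have hclique : ∀ Y : Set V, Y.Pairwise G.Adj → ∀ y₁ ∈ Y, ∀ y₂ ∈ Y, y₁ ≠ y₂ →
      Disjoint W (convexHull ℝ (f '' Y)) := by
    intro Y hY y₁ hy₁ y₂ hy₂ hne
    apply avoid_hull pW hub
    rintro _ ⟨u, hu, rfl⟩ _ ⟨v, hv, rfl⟩
    by_cases huv : u = v
    · subst huv
      have : ∃ w ∈ Y, u ≠ w := by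
        by_cases h : u = y₁
        · exact ⟨y₂, hy₂, by rw [h]; exact hne⟩
        · exact ⟨y₁, hy₁, h⟩
      obtain ⟨w, hw, huw⟩ := this
      refine (hedge u w (hY hu hw huw)).mono_right ?_
      rw [segment_same, Set.singleton_subset_iff]
      exact left_mem_segment _ _ _
    · exact hedge u v (hY hu hv huv)
  have WA := hclique Z hZ z₁ hz₁ z₂ hz₂ d12
  have WB := hclique Z' hZ' z₁' hz₁' z₂' hz₂' d1'2'
  obtain ⟨A, hA⟩ : ∃ A, A = convexHull ℝ (f '' Z) := ⟨_, rfl⟩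
  obtain ⟨B, hB⟩ : ∃ B, B = convexHull ℝ (f '' Z') := ⟨_, rfl⟩
  have cA : Convex ℝ A := hA ▸ convex_convexHull ℝ _
  have cB : Convex ℝ B := hB ▸ convex_convexHull ℝ _
  have clB : IsClosed B := by
    rw [hB]
    exact (Set.Finite.isCompact_convexHull ℝ (Set.toFinite _)).isClosed
  have aA : f z₁ ∈ A := hA ▸ subset_convexHull ℝ _ ⟨_, hz₁, rfl⟩
  have bA : f z₂ ∈ A := hA ▸ subset_convexHull ℝ _ ⟨_, hz₂, rfl⟩
  have cB' : f z₁' ∈ B := hB ▸ subset_convexHull ℝ _ ⟨_, hz₁', rfl⟩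
  have dB : f z₂' ∈ B := hB ▸ subset_convexHull ℝ _ ⟨_, hz₂', rfl⟩
  have hcross2 := hcross.2
  rw [← hA, ← hB] at hcross2
  rw [← hA] at WA
  rw [← hB] at WB
  rw [← hA, ← hB]
  obtain ⟨x, hx, hxC⟩ := hp
  obtain ⟨y, hy, hyC⟩ := hq
  have aB : f z₁ ∉ B := fun h => Set.disjoint_left.1 WB (hCW hxC) (cB.segment_subset h dB hx)
  have bB : f z₂ ∉ B := fun h => Set.disjoint_left.1 WB (hCW hyC) (cB.segment_subset h cB' hy)
  have cA' : f z₁' ∉ A := fun h => Set.disjoint_left.1 WA (hCW hyC) (cA.segment_subset bA h hy)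
  have dA : f z₂' ∉ A := fun h => Set.disjoint_left.1 WA (hCW hxC) (cA.segment_subset aA h hx)
  by_contra hcon
  rw [not_or] at hcon
  obtain ⟨hc1, hc2⟩ := hcon
  have hK1 : connectedComponentIn (A \ B) (f z₁) = connectedComponentIn (A \ B) (f z₂) := by
    by_contra h
    exact hc1 ⟨⟨aA, aB⟩, ⟨bA, bB⟩, h⟩
  have hK2 : connectedComponentIn (B \ A) (f z₁') = connectedComponentIn (B \ A) (f z₂') := by
    by_contra h
    exact hc2 ⟨⟨cB', cA'⟩, ⟨dB, dA⟩, h⟩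
  have hex : ∃ e₀ ∈ A \ B, connectedComponentIn (A \ B) e₀ ≠ connectedComponentIn (A \ B) (f z₁) := by
    obtain ⟨P, hP, hPne, -⟩ := hcross2
    by_cases h : connectedComponentIn (A \ B) (P 0) = connectedComponentIn (A \ B) (f z₁)
    · refine ⟨P 1, hP 1, ?_⟩
      rw [← h]
      exact hPne 1 0 (by decide)
    · exact ⟨P 0, hP 0, h⟩
  obtain ⟨e₀, he₀, hne₀⟩ := hex
  obtain ⟨e, ⟨v, hv, rfl⟩, hseg⟩ := exists_vertex (S := f '' Z) cB clB (hA ▸ he₀)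
  rw [← hA] at hseg
  have hcomp : ∀ u w : Plane, segment ℝ u w ⊆ A \ B →
      connectedComponentIn (A \ B) u = connectedComponentIn (A \ B) w := by
    intro u w huw
    apply connectedComponentIn_eq
    exact (convex_segment u w).isPreconnected.subset_connectedComponentIn
      (left_mem_segment _ _ _) huw (right_mem_segment _ _ _)
  have hne : connectedComponentIn (A \ B) (f v) ≠ connectedComponentIn (A \ B) (f z₁) := by
    rw [← hcomp _ _ hseg]; exact hne₀
  have heAB : f v ∈ A \ B := hseg (right_mem_segment _ _ _)
  have hv1 : f v ≠ f z₁ := fun h => hne (by rw [h])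
  have hv2 : f v ≠ f z₂ := fun h => hne (by rw [h, hK1])
  have h12 : f z₁ ≠ f z₂ := fun h => d12 (hinj h)
  refine plane_core (A := A) (B := B) (K := connectedComponentIn (A \ B) (f z₁))
    (K' := connectedComponentIn (B \ A) (f z₁')) (W := W) (a := f z₁) (b := f z₂) (c := f z₁')
    (d := f z₂') (e := f v)
    (collinear_crossDet (hgen _ ⟨_, rfl⟩ _ ⟨_, rfl⟩ _ ⟨_, rfl⟩ hv1 hv2 h12))
    cA cB (connectedComponentIn_subset _ _) (connectedComponentIn_subset _ _)
    isPreconnected_connectedComponentIn isPreconnected_connectedComponentIn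
    (mem_connectedComponentIn ⟨aA, aB⟩) (hK1 ▸ mem_connectedComponentIn ⟨bA, bB⟩)
    (mem_connectedComponentIn ⟨cB', cA'⟩) (hK2 ▸ mem_connectedComponentIn ⟨dB, dA⟩)
    heAB ?_ pW hub WA WB (hedge _ _ he₁) (hedge _ _ he₃.symm)
    ⟨x, hx, hCW hxC⟩ ⟨y, hy, hCW hyC⟩
  intro w hw
  by_contra hemp
  apply hne
  have hwA := (connectedComponentIn_subset _ _ hw).1
  rw [hcomp (f v) w, ← connectedComponentIn_eq hw]
  intro z hz
  exact ⟨cA.segment_subset heAB.1 hwA hz, fun hzB => hemp ⟨z, hz, hzB⟩⟩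

end
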